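/- Let n ≥ 2 and let y ∈ S_n be 312-avoiding with y_{n-1} = n and y_n = k. Let w ∈ S_{n-2} be obtained from the word y_1 ⋯ y_{n-2} by replacing each entry v with v - 1 whenever v > k (entries less than k are unchanged). Suppose x' ∈ S_{n-2} is 312-avoiding and sylvester-congruent to Pop_{S_{n-2}}(w), and let x'' be the word obtained from x' by replacing each entry v ≥ k with v + 1. Then the word x''·k·n (concatenation) is 312-avoiding and sylvester-congruent to Pop_{S_n}(y). -/

import Mathlib

/-- `w` is (the word of) a permutation of `{1, …, n}`. -/
def IsPermWord (n : ℕ) (w : List ℕ) : Prop := w.Perm (List.range' 1 n)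

/-- `w` is 312-avoiding: there are no positions `i < j < k` with `w_j < w_k < w_i`. -/
def Avoids312 (w : List ℕ) : Prop :=
  ¬ ∃ i j k : ℕ, i < j ∧ j < k ∧ k < w.length ∧
      w.getD j 0 < w.getD k 0 ∧ w.getD k 0 < w.getD i 0

/-- `w` is 231-avoiding: there are no positions `i < j < k` with `w_k < w_i < w_j`. -/
def Avoids231 (w : List ℕ) : Prop :=
  ¬ ∃ i j k : ℕ, i < j ∧ j < k ∧ k < w.length ∧
      w.getD k 0 < w.getD i 0 ∧ w.getD i 0 < w.getD j 0

/-- `w` has a double descent: three consecutive strictly decreasing entries. -/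
def HasDoubleDescent (w : List ℕ) : Prop :=
  ∃ i : ℕ, i + 2 < w.length ∧
    w.getD (i + 1) 0 < w.getD i 0 ∧ w.getD (i + 2) 0 < w.getD (i + 1) 0

/-- Length of the maximal strictly decreasing run at the start of a word. -/
def decRunLen : List ℕ → ℕ
  | [] => 0
  | [_] => 1
  | a :: b :: rest => if b < a then decRunLen (b :: rest) + 1 else 1

lemma one_le_decRunLen (a : ℕ) (t : List ℕ) : 1 ≤ decRunLen (a :: t) := by
  cases t <;> simp [decRunLen] <;> split <;> omega

/-- The pop-stack-sorting map on words: reverse every maximal descending run. -/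
def popWord (w : List ℕ) : List ℕ :=
  match w with
  | [] => []
  | a :: t =>
      ((a :: t).take (decRunLen (a :: t))).reverse ++
        popWord ((a :: t).drop (decRunLen (a :: t)))
termination_by w.length
decreasing_by
  have := one_le_decRunLen a t
  simp [List.length_drop]
  omega

/-- Two words are sylvester-adjacent if one is `X a c Y b Z` and the other is
`X c a Y b Z` for letters `a < b < c`. -/
def SylvAdj (u v : List ℕ) : Prop :=
  ∃ (X Y Z : List ℕ) (a b c : ℕ), a < b ∧ b < c ∧
    u = X ++ a :: c :: (Y ++ b :: Z) ∧ v = X ++ c :: a :: (Y ++ b :: Z)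

/-- The sylvester congruence: the reflexive-symmetric-transitive closure of
sylvester-adjacency. -/
def SylvCongr : List ℕ → List ℕ → Prop := Relation.EqvGen SylvAdj

lemma avoids312_iff_sublist (w : List ℕ) :
    Avoids312 w ↔ ∀ a b c, a < b → b < c → ¬ [c, a, b].Sublist w := by
  constructor
  · intro h a b c hab hbc hs
    obtain ⟨f, hf⟩ := List.sublist_iff_exists_fin_orderEmbedding_get_eq.1 hs
    have h0 := hf ⟨0, by simp⟩
    have h1 := hf ⟨1, by simp⟩
    have h2 := hf ⟨2, by simp⟩
    have l01 : f ⟨0, by simp⟩ < f ⟨1, by simp⟩ := f.lt_iff_lt.2 (by simp)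
    have l12 : f ⟨1, by simp⟩ < f ⟨2, by simp⟩ := f.lt_iff_lt.2 (by simp)
    simp only [List.get_eq_getElem, List.getElem_cons_zero, List.getElem_cons_succ] at h0 h1 h2
    refine h ⟨_, _, _, l01, l12, (f ⟨2, by simp⟩).2, ?_, ?_⟩
    · rwa [List.getD_eq_getElem _ _ (Fin.is_lt _), List.getD_eq_getElem _ _ (Fin.is_lt _), ← h1, ← h2]
    · rwa [List.getD_eq_getElem _ _ (Fin.is_lt _), List.getD_eq_getElem _ _ (Fin.is_lt _), ← h2, ← h0]
  · rintro h ⟨i, j, k, hij, hjk, hk, h1, h2⟩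
    rw [List.getD_eq_getElem _ _ (by omega), List.getD_eq_getElem _ _ (by omega)] at h1 h2
    refine h _ _ _ h1 h2 ?_
    have hs : ([⟨i, by omega⟩, ⟨j, by omega⟩, ⟨k, hk⟩] : List (Fin w.length)).Pairwise (· < ·) := by
      simp [hij, hjk, hij.trans hjk]
    exact List.map_getElem_sublist hs

lemma sublist_pair_swap {X W : List ℕ} {a c p q : ℕ}
    (h : [p, q].Sublist (X ++ a :: c :: W)) :
    [p, q].Sublist (X ++ c :: a :: W) ∨ (p = a ∧ q = c) := by
  induction X with
  | nil =>
    simp only [List.nil_append, List.sublist_cons_iff, List.cons.injEq] at h ⊢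
    grind
  | cons x X ih =>
    simp only [List.cons_append, List.sublist_cons_iff (a := x)] at h ⊢
    grind

lemma sublist_triple_swap {X W : List ℕ} {a c p q r : ℕ}
    (h : [p, q, r].Sublist (X ++ a :: c :: W)) :
    [p, q, r].Sublist (X ++ c :: a :: W) ∨ (p = a ∧ q = c) ∨ (p ∈ X ∧ q = a ∧ r = c) := by
  induction X with
  | nil =>
    simp only [List.nil_append, List.sublist_cons_iff] at h ⊢
    grind
  | cons x X ih =>
    simp only [List.cons_append, List.sublist_cons_iff (a := x)] at h ⊢
    rcases h with h | ⟨r', h, h'⟩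
    · grind
    · obtain ⟨rfl, rfl⟩ := List.cons.inj h
      have := sublist_pair_swap h'
      grind

lemma not_pair_sublist_of_nodup {X W : List ℕ} {a c : ℕ} (h : (X ++ a :: c :: W).Nodup) :
    ¬ [c, a].Sublist (X ++ a :: c :: W) := by
  induction X with
  | nil => simp only [List.nil_append, List.sublist_cons_iff]; grind
  | cons x X ih =>
    obtain ⟨hx, hX⟩ := List.nodup_cons.1 h
    rintro (_ | hs)
    · exact ih hX ‹_›
    · exact hx (by simp)

lemma SylvAdj.perm {u v : List ℕ} (h : SylvAdj u v) : u.Perm v := by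
  obtain ⟨X, Y, Z, a, b, c, -, -, rfl, rfl⟩ := h
  exact (List.Perm.swap c a _).append_left X

/-- Every inversion `c ⋯ a` of `w` with `a < k ≤ c` is followed by some `b` with `a < b < c`. -/
def CrossingsCovered (k : ℕ) (w : List ℕ) : Prop :=
  ∀ a c, a < k → k ≤ c → [c, a].Sublist w → ∃ b, a < b ∧ b < c ∧ [c, a, b].Sublist w

lemma SylvAdj.crossingsCovered_iff {k : ℕ} {u v : List ℕ} (h : SylvAdj u v) (hu : u.Nodup) :
    CrossingsCovered k u ↔ CrossingsCovered k v := by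
  obtain ⟨X, Y, Z, a, b, c, hab, hbc, rfl, rfl⟩ := h
  have hb : [b].Sublist (Y ++ b :: Z) := by simp
  constructor
  · intro h p q hp hq hs
    rcases sublist_pair_swap hs with h' | ⟨rfl, rfl⟩
    · obtain ⟨r, hpr, hrq, hr⟩ := h p q hp hq h'
      rcases sublist_triple_swap hr with hr | ⟨rfl, rfl⟩ | ⟨hX, rfl, rfl⟩
      · exact ⟨r, hpr, hrq, hr⟩
      · omega
      · exact ⟨b, hab, hbc.trans hrq, (List.singleton_sublist.2 hX).append
          (((hb.cons_cons _)).cons _)⟩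
    · exact ⟨b, hab, hbc, List.sublist_append_of_sublist_right ((hb.cons_cons _).cons_cons _)⟩
  · intro h p q hp hq hs
    rcases sublist_pair_swap hs with h' | ⟨rfl, rfl⟩
    · obtain ⟨r, hpr, hrq, hr⟩ := h p q hp hq h'
      rcases sublist_triple_swap hr with hr | ⟨rfl, rfl⟩ | ⟨hX, rfl, rfl⟩
      · exact ⟨r, hpr, hrq, hr⟩
      · exact absurd hs (not_pair_sublist_of_nodup hu)
      · omega
    · omega

lemma SylvCongr.perm {u v : List ℕ} (h : SylvCongr u v) : u.Perm v := by
  induction h with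
  | rel _ _ h => exact h.perm
  | refl => rfl
  | symm _ _ _ ih => exact ih.symm
  | trans _ _ _ _ _ ih₁ ih₂ => exact ih₁.trans ih₂

lemma SylvCongr.crossingsCovered_iff {k : ℕ} {u v : List ℕ} (h : SylvCongr u v) (hu : u.Nodup) :
    CrossingsCovered k u ↔ CrossingsCovered k v := by
  induction h with
  | rel _ _ h => exact h.crossingsCovered_iff hu
  | refl => rfl
  | symm _ _ h ih => exact (ih ((SylvCongr.perm h).nodup_iff.2 hu)).symm
  | trans _ _ _ h _ ih₁ ih₂ => exact (ih₁ hu).trans (ih₂ ((SylvCongr.perm h).nodup_iff.1 hu))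

lemma SylvCongr.map_append {u v : List ℕ} (h : SylvCongr u v) {f : ℕ → ℕ} (hf : StrictMono f)
    (t : List ℕ) : SylvCongr (u.map f ++ t) (v.map f ++ t) := by
  induction h with
  | rel _ _ h =>
    obtain ⟨X, Y, Z, a, b, c, hab, hbc, rfl, rfl⟩ := h
    exact .rel _ _ ⟨X.map f, Y.map f, Z.map f ++ t, f a, f b, f c, hf hab, hf hbc, by simp, by simp⟩
  | refl => exact .refl _
  | symm _ _ _ ih => exact .symm _ _ ih
  | trans _ _ _ _ _ ih₁ ih₂ => exact .trans _ _ _ ih₁ ih₂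

lemma decRunLen_map {f : ℕ → ℕ} (hf : StrictMono f) (w : List ℕ) :
    decRunLen (w.map f) = decRunLen w := by
  induction w using decRunLen.induct <;> grind [decRunLen, hf.lt_iff_lt]

lemma popWord_map {f : ℕ → ℕ} (hf : StrictMono f) (w : List ℕ) :
    popWord (w.map f) = (popWord w).map f := by
  induction w using popWord.induct with
  | case1 => simp [popWord]
  | case2 a t ih =>
    have hr := decRunLen_map hf (a :: t)
    rw [List.map_cons] at hr
    rw [popWord, List.map_cons, popWord, hr, ← List.map_cons, ← List.map_drop, ih, ← List.map_take,
      ← List.map_reverse, List.map_append]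

lemma decRunLen_append {u v : List ℕ} {m : ℕ} (hu : u ≠ []) (h : ∀ a ∈ u, a ≤ m) :
    decRunLen (u ++ m :: v) = decRunLen u := by
  induction u using decRunLen.induct with
  | case2 a => simp [decRunLen, h a (by simp)]
  | _ => grind [decRunLen]

lemma decRunLen_le_length (w : List ℕ) : decRunLen w ≤ w.length := by
  induction w using decRunLen.induct <;> grind [decRunLen]

lemma popWord_append {u v : List ℕ} {m : ℕ} (h : ∀ a ∈ u, a ≤ m) :
    popWord (u ++ m :: v) = popWord u ++ popWord (m :: v) := by
  induction u using popWord.induct with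
  | case1 => simp [popWord]
  | case2 a t ih =>
    have hr := decRunLen_append (v := v) (List.cons_ne_nil a t) h
    have hl := decRunLen_le_length (a :: t)
    rw [List.cons_append] at hr
    rw [popWord, List.cons_append, popWord, hr, ← List.cons_append, List.take_append_of_le_length hl,
      List.drop_append_of_le_length hl, ih fun b hb => h b (List.mem_of_mem_drop hb),
      List.append_assoc]

lemma popWord_perm (w : List ℕ) : (popWord w).Perm w := by
  induction w using popWord.induct with
  | case1 => simp [popWord]
  | case2 a t ih =>
    rw [popWord]
    exact ((List.reverse_perm _).append ih).trans (by rw [List.take_append_drop])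

lemma pairwise_take_decRunLen (w : List ℕ) : (w.take (decRunLen w)).Pairwise (· > ·) := by
  rw [← List.isChain_iff_pairwise]
  induction w using decRunLen.induct with
  | case1 => simp
  | case2 => simp [decRunLen]
  | case3 a b t h ih =>
    obtain ⟨m, hm⟩ := Nat.exists_eq_add_of_le' (one_le_decRunLen b t)
    simp_all [decRunLen]
  | case4 a b t h => simp [decRunLen, h]

/-- If every letter at least `k` comes after all letters below `k`, then popping preserves this. -/
lemma pairwise_popWord {k : ℕ} {w : List ℕ} (h : w.Pairwise fun p q => k ≤ p → k ≤ q) :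
    (popWord w).Pairwise fun p q => k ≤ p → k ≤ q := by
  induction w using popWord.induct with
  | case1 => simp [popWord]
  | case2 a t ih =>
    rw [popWord]
    rw [← List.take_append_drop (decRunLen (a :: t)) (a :: t), List.pairwise_append] at h
    refine List.pairwise_append.2 ⟨?_, ih h.2.1, fun p hp q hq => ?_⟩
    · rw [List.pairwise_reverse]
      exact (pairwise_take_decRunLen _).imp fun hpq hq => hq.trans hpq.le
    · exact h.2.2 p (List.mem_reverse.1 hp) q ((popWord_perm _).mem_iff.1 hq)

lemma strictMono_shift (k : ℕ) : StrictMono fun v : ℕ => if k ≤ v then v + 1 else v := by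
  intro a b h
  dsimp only
  split <;> split <;> omega

lemma eq_append_of_penultimate {n k : ℕ} (hn : 2 ≤ n) {y : List ℕ} (hlen : y.length = n)
    (hpen : y.getD (n - 2) 0 = n) (hlast : y.getD (n - 1) 0 = k) :
    y = y.take (n - 2) ++ [n, k] := by
  rw [List.getD_eq_getElem _ _ (by omega)] at hpen hlast
  have h : y.drop (n - 2) = [n, k] := by
    rw [List.drop_eq_getElem_cons (by omega), List.drop_eq_getElem_cons (by omega), hpen,
      List.drop_eq_nil_of_le (by omega)]
    simp only [show n - 2 + 1 = n - 1 by omega, hlast]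
  rw [← h, List.take_append_drop]

lemma avoids312_append {n k : ℕ} {x : List ℕ} (hx : Avoids312 x) (hle : ∀ v ∈ x, v ≤ n)
    (hkn : k ≤ n) (h : x.Pairwise fun p q => k < p → k ≤ q) : Avoids312 (x ++ [k, n]) := by
  rw [avoids312_iff_sublist] at hx ⊢
  intro a b c hab hbc hs
  have hc : c ≤ n := by
    have : c ∈ x ++ [k, n] := hs.subset (by simp)
    grind
  rw [show x ++ [k, n] = (x ++ [k]) ++ [n] by simp, show [c, a, b] = [c, a] ++ [b] from rfl] at hs
  have hs' := List.reverse_sublist.2 hs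
  simp only [List.reverse_append, List.reverse_singleton, List.singleton_append,
    List.sublist_cons_iff, List.cons.injEq] at hs'
  rcases hs' with (hs' | ⟨r, ⟨rfl, rfl⟩, hs'⟩) | ⟨r, ⟨rfl, rfl⟩, hs'⟩
  · exact hx a b c hab hbc (List.reverse_sublist.1 (by simpa using hs'))
  · have := List.pairwise_iff_forall_sublist.1 h (List.reverse_sublist.1 hs') hbc
    omega
  · omega

/-- **Theorem (Statement 12).** Let `n ≥ 2` and let `y ∈ S_n` be 312-avoiding with
`y_{n-1} = n` and `y_n = k`.  Let `w ∈ S_{n-2}` be obtained from `y_1 ⋯ y_{n-2}` by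
replacing each entry `v > k` with `v - 1`.  If `x' ∈ S_{n-2}` is 312-avoiding and
sylvester-congruent to `Pop(w)`, and `x''` is obtained from `x'` by replacing each
entry `v ≥ k` with `v + 1`, then `x''·k·n` is 312-avoiding and sylvester-congruent
to `Pop(y)`. -/
theorem pop_sylv_congr_penultimate_max (n k : ℕ) (hn : 2 ≤ n) (y : List ℕ)
    (hy : IsPermWord n y) (hy312 : Avoids312 y)
    (hpen : y.getD (n - 2) 0 = n) (hlast : y.getD (n - 1) 0 = k)
    (x' : List ℕ) (hx' : IsPermWord (n - 2) x') (hx'312 : Avoids312 x')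
    (hcong : SylvCongr x'
      (popWord ((y.take (n - 2)).map (fun v => if k < v then v - 1 else v)))) :
    Avoids312 ((x'.map fun v => if k ≤ v then v + 1 else v) ++ [k, n]) ∧
      SylvCongr ((x'.map fun v => if k ≤ v then v + 1 else v) ++ [k, n]) (popWord y) := by
  set φ : ℕ → ℕ := fun v => if k ≤ v then v + 1 else v with hφ
  have hmono : StrictMono φ := strictMono_shift k
  set u := y.take (n - 2) with hu
  set w := u.map fun v => if k < v then v - 1 else v with hw
  have hyu : y = u ++ [n, k] :=
    eq_append_of_penultimate hn (by simpa using hy.length_eq) hpen hlast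
  have hnd : y.Nodup := hy.nodup_iff.2 List.nodup_range'
  have hyle : ∀ v ∈ y, v ≤ n := fun v hv => by
    have := hy.mem_iff.1 hv
    simp at this
    omega
  have hku : k ∉ u := by
    rw [hyu] at hnd
    intro hk
    exact (List.nodup_append.1 hnd).2.2 k hk k (by simp) rfl
  have hkn : k < n := by
    refine lt_of_le_of_ne (hyle k (by simp [hyu])) ?_
    rintro rfl
    rw [hyu] at hnd
    exact absurd (List.nodup_append.1 hnd).2.1 (by simp)
  have hwu : w.map φ = u := by
    rw [hw, List.map_map]
    refine (List.map_congr_left fun v hv => ?_).trans (List.map_id u)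
    have : v ≠ k := fun h => hku (h ▸ hv)
    simp only [hφ, Function.comp, id]
    split_ifs <;> omega
  have hpop : popWord y = (popWord w).map φ ++ [k, n] := by
    rw [hyu, popWord_append fun a ha => hyle a (by simp [hyu, ha]), ← popWord_map hmono, hwu]
    simp [popWord, decRunLen, hkn]
  refine ⟨?_, hpop ▸ hcong.map_append hmono _⟩
  have hpw : w.Pairwise fun p q => k ≤ p → k ≤ q := by
    refine List.pairwise_iff_forall_sublist.2 fun {p q} hs hp => ?_
    by_contra! hq
    refine (avoids312_iff_sublist y).1 hy312 (φ q) k (φ p) (by grind) (by grind) ?_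
    rw [hyu, ← hwu]
    exact (hs.map φ).append (show [k].Sublist [n, k] by simp)
  have hcov : CrossingsCovered k x' := by
    refine (hcong.crossingsCovered_iff (hx'.nodup_iff.2 List.nodup_range')).2 fun a c ha hc hs => ?_
    have := List.pairwise_iff_forall_sublist.1 (pairwise_popWord hpw) hs hc
    omega
  refine avoids312_append ?_ ?_ hkn.le ?_
  · rw [avoids312_iff_sublist] at hx'312 ⊢
    intro a b c hab hbc hs
    obtain ⟨l, hl, he⟩ := List.sublist_map_iff.1 hs
    match l, he with
    | [c', a', b'], he =>
      simp only [List.map_cons, List.map_nil, List.cons.injEq, and_true] at he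
      obtain ⟨rfl, rfl, rfl⟩ := he
      exact hx'312 _ _ _ (hmono.lt_iff_lt.1 hab) (hmono.lt_iff_lt.1 hbc) hl
  · intro v hv
    obtain ⟨v', hv', rfl⟩ := List.mem_map.1 hv
    have := hx'.mem_iff.1 hv'
    simp at this
    grind
  · refine List.pairwise_map.2 (List.pairwise_iff_forall_sublist.2 fun {p q} hs hp => ?_)
    by_contra! hq
    obtain ⟨b, hab, hbc, hb⟩ := hcov q p (by grind) (by grind) hs
    exact (avoids312_iff_sublist x').1 hx'312 _ _ _ hab hbc hb
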